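/- Let n ≥ k ≥ 1. The projection map B ↦ π_B = B(BᵀB)⁻¹Bᵀ, defined on the open set of n×k real matrices of full column rank, is Fréchet differentiable at every such B, and its derivative in direction d (an arbitrary n×k real matrix) is given by Dπ_B(d) = (I − π_B) d Y Bᵀ + B Y dᵀ (I − π_B), where Y = (BᵀB)⁻¹. -/

import Mathlib

open scoped Matrix

attribute [local instance] Matrix.normedAddCommGroup Matrix.normedSpace

/-- The orthogonal projection `π_B = B (BᵀB)⁻¹ Bᵀ` onto the column span of a
full-column-rank matrix `B`. -/
noncomputable def piMat {m q : Type*} [Fintype m] [Fintype q] [DecidableEq q]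
    (B : Matrix m q ℝ) : Matrix m m ℝ :=
  B * (Bᵀ * B)⁻¹ * Bᵀ

namespace Matrix

/-- Product rule for rectangular matrices. -/
theorem hasFDerivAt_mul {E l m p : Type*} [NormedAddCommGroup E] [NormedSpace ℝ E]
    [Fintype l] [Fintype m] [Fintype p]
    {f : E → Matrix l m ℝ} {g : E → Matrix m p ℝ}
    {f' : E →L[ℝ] Matrix l m ℝ} {g' : E →L[ℝ] Matrix m p ℝ} {x : E}
    (hf : HasFDerivAt f f' x) (hg : HasFDerivAt g g' x) :
    ∃ h' : E →L[ℝ] Matrix l p ℝ, HasFDerivAt (fun y => f y * g y) h' x ∧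
      ∀ d, h' d = f x * g' d + f' d * g x := by
  let L : Matrix l m ℝ →ₗ[ℝ] Matrix m p ℝ →ₗ[ℝ] Matrix l p ℝ :=
    LinearMap.mk₂ ℝ (fun A C => A * C) Matrix.add_mul Matrix.smul_mul Matrix.mul_add
      (fun c A C => Matrix.mul_smul A c C)
  exact ⟨_, L.toContinuousBilinearMap.hasFDerivAt_of_bilinear hf hg, fun d => rfl⟩

theorem hasFDerivAt_transpose {E l m : Type*} [NormedAddCommGroup E] [NormedSpace ℝ E]
    [Fintype l] [Fintype m] {f : E → Matrix l m ℝ} {f' : E →L[ℝ] Matrix l m ℝ} {x : E}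
    (hf : HasFDerivAt f f' x) :
    ∃ h' : E →L[ℝ] Matrix m l ℝ, HasFDerivAt (fun y => (f y)ᵀ) h' x ∧ ∀ d, h' d = (f' d)ᵀ :=
  ⟨_, (transposeLinearEquiv l m ℝ ℝ).toLinearMap.toContinuousLinearMap.hasFDerivAt.comp x hf,
    fun _ => rfl⟩

theorem hasFDerivAt_inv {E m : Type*} [NormedAddCommGroup E] [NormedSpace ℝ E]
    [Fintype m] [DecidableEq m] {f : E → Matrix m m ℝ} {f' : E →L[ℝ] Matrix m m ℝ} {x : E}
    (hf : HasFDerivAt f f' x) (hx : IsUnit (f x)) :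
    ∃ h' : E →L[ℝ] Matrix m m ℝ, HasFDerivAt (fun y => (f y)⁻¹) h' x ∧
      ∀ d, h' d = -((f x)⁻¹ * f' d * (f x)⁻¹) := by
  obtain ⟨u, hu⟩ := hx
  obtain ⟨g', hg, hg'⟩ : ∃ g' : Matrix m m ℝ →L[ℝ] Matrix m m ℝ,
      HasFDerivAt (fun C : Matrix m m ℝ => C⁻¹) g' (f x) ∧
        ∀ d, g' d = -((f x)⁻¹ * d * (f x)⁻¹) := by
    let := Matrix.linftyOpNormedRing (n := m) (α := ℝ)
    let := Matrix.linftyOpNormedAlgebra (n := m) (R := ℝ) (α := ℝ)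
    have : HasSummableGeomSeries (Matrix m m ℝ) :=
      have := FiniteDimensional.complete ℝ (Matrix m m ℝ)
      @instHasSummableGeomSeriesOfCompleteSpace _ _ this
    have key := hasFDerivAt_ringInverse (𝕜 := ℝ) u
    simp only [nonsing_inv_eq_ringInverse, ← hu, Ring.inverse_unit]
    exact ⟨_, key, fun d => rfl⟩
  exact ⟨_, hg.comp x hf, fun d => hg' (f' d)⟩

theorem isUnit_transpose_mul_self {m p : Type*} [Fintype m] [Fintype p] [DecidableEq p]
    {B : Matrix m p ℝ} (hB : B.rank = Fintype.card p) : IsUnit (Bᵀ * B) := by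
  rw [← rank_transpose_mul_self, rank_eq_finrank_span_cols] at hB
  exact linearIndependent_cols_iff_isUnit.1 (linearIndependent_iff_card_eq_finrank_span.2 hB.symm)

end Matrix

/-- The derivative of the projection onto the column span of a family of matrices. -/
theorem hasFDerivAt_piMat {E m p : Type*} [NormedAddCommGroup E] [NormedSpace ℝ E]
    [Fintype m] [DecidableEq m] [Fintype p] [DecidableEq p]
    {f : E → Matrix m p ℝ} {f' : E →L[ℝ] Matrix m p ℝ} {x : E}
    (hf : HasFDerivAt f f' x) (hx : (f x).rank = Fintype.card p) :
    ∃ h' : E →L[ℝ] Matrix m m ℝ, HasFDerivAt (fun y => piMat (f y)) h' x ∧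
      ∀ d, h' d = (1 - piMat (f x)) * f' d * ((f x)ᵀ * f x)⁻¹ * (f x)ᵀ +
        f x * ((f x)ᵀ * f x)⁻¹ * (f' d)ᵀ * (1 - piMat (f x)) := by
  obtain ⟨T', hT, hT'⟩ := Matrix.hasFDerivAt_transpose hf
  obtain ⟨G', hG, hG'⟩ := Matrix.hasFDerivAt_mul hT hf
  obtain ⟨Y', hY, hY'⟩ := Matrix.hasFDerivAt_inv hG (Matrix.isUnit_transpose_mul_self hx)
  obtain ⟨Q', hQ, hQ'⟩ := Matrix.hasFDerivAt_mul hf hY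
  obtain ⟨P', hP, hP'⟩ := Matrix.hasFDerivAt_mul hQ hT
  refine ⟨P', hP, fun d => ?_⟩
  simp only [hP', hQ', hY', hG', hT', piMat]
  simp only [Matrix.mul_add, Matrix.add_mul, Matrix.mul_sub, Matrix.sub_mul, Matrix.mul_neg,
    Matrix.neg_mul, Matrix.mul_assoc, Matrix.one_mul, Matrix.mul_one]
  abel

/-- The projection map `B ↦ π_B = B (BᵀB)⁻¹ Bᵀ` is Fréchet differentiable at
every full-column-rank `B`, with derivative in direction `d` given by
`Dπ_B(d) = (I − π_B) d Y Bᵀ + B Y dᵀ (I − π_B)`, where `Y = (BᵀB)⁻¹`. -/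
theorem deriv_proj (n k : ℕ) (hk : 1 ≤ k) (hkn : k ≤ n)
    (B : Matrix (Fin n) (Fin k) ℝ) (hB : B.rank = k) :
    ∃ P' : Matrix (Fin n) (Fin k) ℝ →L[ℝ] Matrix (Fin n) (Fin n) ℝ,
      HasFDerivAt (fun B' : Matrix (Fin n) (Fin k) ℝ => piMat B') P' B ∧
      ∀ d : Matrix (Fin n) (Fin k) ℝ,
        P' d = ((1 : Matrix (Fin n) (Fin n) ℝ) - piMat B) * d * (Bᵀ * B)⁻¹ * Bᵀ +
          B * (Bᵀ * B)⁻¹ * dᵀ * ((1 : Matrix (Fin n) (Fin n) ℝ) - piMat B) := by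
  obtain ⟨P', hP, hP'⟩ := hasFDerivAt_piMat (hasFDerivAt_id (𝕜 := ℝ) B) (by simpa using hB)
  exact ⟨P', hP, fun d => hP' d⟩
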